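/- arXiv:2206.11857 — 8 statements merged into one kernel-verified Lean document; each statement's English description precedes it below -/
import Mathlib

section
/- (Main identity, linear least norm case.) Let A₁ be an m₁×n and A₂ an m₂×n real matrix, b₁ ∈ ℝ^{m₁}, b₂ ∈ ℝ^{m₂}. Let A be the stacked (m₁+m₂)×n matrix (A₁ on top of A₂) and b ∈ ℝ^{m₁+m₂} the stacked vector (b₁ on top of b₂). Assume A₁A₁ᵀ and A Aᵀ are invertible, and set x₁⋆ := A₁ᵀ(A₁A₁ᵀ)⁻¹b₁ and W := A₂ (I − A₁ᵀ(A₁A₁ᵀ)⁻¹A₁) A₂ᵀ. Then bᵀ (A Aᵀ)⁻¹ b = b₁ᵀ (A₁A₁ᵀ)⁻¹ b₁ + (A₂ x₁⋆ − b₂)ᵀ W⁻¹ (A₂ x₁⋆ − b₂). -/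
open Matrix

namespace Matrix

variable {l m R : Type*} [Fintype l] [Fintype m] [DecidableEq l] [DecidableEq m] [CommRing R]

/-- Block elimination: the solution of a `2 × 2` block linear system in terms of the inverse of the
upper left block and of its Schur complement. -/
theorem inv_fromBlocks_mulVec_sumElim {P : Matrix l l R} {B : Matrix l m R} {C : Matrix m l R}
    {D : Matrix m m R} (hP : IsUnit P) (h : IsUnit (fromBlocks P B C D)) (x : l → R) (y : m → R) :
    (fromBlocks P B C D)⁻¹ *ᵥ Sum.elim x y =
      Sum.elim
        (P⁻¹ *ᵥ x + P⁻¹ *ᵥ B *ᵥ (D - C * P⁻¹ * B)⁻¹ *ᵥ (C *ᵥ P⁻¹ *ᵥ x - y))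
        (-((D - C * P⁻¹ * B)⁻¹ *ᵥ (C *ᵥ P⁻¹ *ᵥ x - y))) := by
  have hS : IsUnit (D - C * P⁻¹ * B) := by
    let := hP.invertible
    simpa [invOf_eq_nonsing_inv] using isUnit_fromBlocks_iff_of_invertible₁₁.mp h
  have hP' : P * P⁻¹ = 1 := mul_nonsing_inv _ ((isUnit_iff_isUnit_det _).mp hP)
  have hS' := mul_nonsing_inv _ ((isUnit_iff_isUnit_det _).mp hS)
  have hM := nonsing_inv_mul _ ((isUnit_iff_isUnit_det _).mp h)
  set r := C *ᵥ P⁻¹ *ᵥ x - y with hr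
  set z := (D - C * P⁻¹ * B)⁻¹ *ᵥ r with hz
  have hzr : D *ᵥ z - C *ᵥ P⁻¹ *ᵥ B *ᵥ z = r := by
    have : (D - C * P⁻¹ * B) *ᵥ z = r := by rw [hz, mulVec_mulVec, hS', one_mulVec]
    simpa [sub_mulVec, mulVec_mulVec, Matrix.mul_assoc] using this
  have hPP (v : l → R) : P *ᵥ P⁻¹ *ᵥ v = v := by rw [mulVec_mulVec, hP', one_mulVec]
  have hsol : Sum.elim x y =
      fromBlocks P B C D *ᵥ Sum.elim (P⁻¹ *ᵥ x + P⁻¹ *ᵥ B *ᵥ z) (-z) := by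
    rw [fromBlocks_mulVec]
    simp only [Sum.elim_comp_inl, Sum.elim_comp_inr, mulVec_add, mulVec_neg, hPP]
    congr 1
    · abel
    · have hy : y = C *ᵥ P⁻¹ *ᵥ x - (D *ᵥ z - C *ᵥ P⁻¹ *ᵥ B *ᵥ z) := by
        rw [hzr, hr]; abel
      exact hy.trans (by abel)
  rw [hsol, mulVec_mulVec, hM, one_mulVec]

/-- The quadratic form of the inverse of a symmetric block matrix, split along the blocks. -/
theorem sumElim_dotProduct_inv_fromBlocks_mulVec {P : Matrix l l R} {B : Matrix l m R}
    {D : Matrix m m R} (hPs : P.IsSymm) (hP : IsUnit P) (h : IsUnit (fromBlocks P B Bᵀ D))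
    (x : l → R) (y : m → R) :
    Sum.elim x y ⬝ᵥ (fromBlocks P B Bᵀ D)⁻¹ *ᵥ Sum.elim x y =
      x ⬝ᵥ P⁻¹ *ᵥ x +
        (Bᵀ *ᵥ P⁻¹ *ᵥ x - y) ⬝ᵥ (D - Bᵀ * P⁻¹ * B)⁻¹ *ᵥ (Bᵀ *ᵥ P⁻¹ *ᵥ x - y) := by
  rw [inv_fromBlocks_mulVec_sumElim hP h, sumElim_dotProduct_sumElim]
  generalize (D - Bᵀ * P⁻¹ * B)⁻¹ *ᵥ (Bᵀ *ᵥ P⁻¹ *ᵥ x - y) = z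
  have hcross : x ⬝ᵥ P⁻¹ *ᵥ B *ᵥ z = (Bᵀ *ᵥ P⁻¹ *ᵥ x) ⬝ᵥ z := by
    rw [dotProduct_mulVec, dotProduct_mulVec, ← mulVec_transpose, ← mulVec_transpose,
      transpose_nonsing_inv, hPs.eq]
  rw [dotProduct_add, dotProduct_neg, sub_dotProduct, hcross]
  ring

end Matrix

/-- Main identity (linear least norm case):
`bᵀ (A Aᵀ)⁻¹ b = b₁ᵀ (A₁A₁ᵀ)⁻¹ b₁ + (A₂ x₁⋆ - b₂)ᵀ W⁻¹ (A₂ x₁⋆ - b₂)`,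
where `x₁⋆ = A₁ᵀ(A₁A₁ᵀ)⁻¹b₁` and `W = A₂ (I - A₁ᵀ(A₁A₁ᵀ)⁻¹A₁) A₂ᵀ`. -/
theorem minNorm_optimal_value_decomposition {m₁ m₂ n : ℕ}
    (A₁ : Matrix (Fin m₁) (Fin n) ℝ) (A₂ : Matrix (Fin m₂) (Fin n) ℝ)
    (b₁ : Fin m₁ → ℝ) (b₂ : Fin m₂ → ℝ)
    (h₁ : IsUnit (A₁ * A₁ᵀ))
    (h : IsUnit (Matrix.fromRows A₁ A₂ * (Matrix.fromRows A₁ A₂)ᵀ)) :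
    (Sum.elim b₁ b₂) ⬝ᵥ
        ((Matrix.fromRows A₁ A₂ * (Matrix.fromRows A₁ A₂)ᵀ)⁻¹).mulVec (Sum.elim b₁ b₂)
      = b₁ ⬝ᵥ ((A₁ * A₁ᵀ)⁻¹).mulVec b₁
        + (A₂.mulVec ((A₁ᵀ * (A₁ * A₁ᵀ)⁻¹).mulVec b₁) - b₂) ⬝ᵥ
            ((A₂ * (1 - A₁ᵀ * (A₁ * A₁ᵀ)⁻¹ * A₁) * A₂ᵀ)⁻¹).mulVec
              (A₂.mulVec ((A₁ᵀ * (A₁ * A₁ᵀ)⁻¹).mulVec b₁) - b₂) := by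
  have hM : fromRows A₁ A₂ * (fromRows A₁ A₂)ᵀ =
      fromBlocks (A₁ * A₁ᵀ) (A₁ * A₂ᵀ) (A₁ * A₂ᵀ)ᵀ (A₂ * A₂ᵀ) := by
    rw [transpose_fromRows, fromRows_mul_fromCols, transpose_mul, transpose_transpose]
  have hW : A₂ * (1 - A₁ᵀ * (A₁ * A₁ᵀ)⁻¹ * A₁) * A₂ᵀ =
      A₂ * A₂ᵀ - (A₁ * A₂ᵀ)ᵀ * (A₁ * A₁ᵀ)⁻¹ * (A₁ * A₂ᵀ) := by
    simp only [transpose_mul, transpose_transpose, Matrix.mul_sub, Matrix.sub_mul, Matrix.mul_one,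
      Matrix.mul_assoc]
  have hx : A₂ *ᵥ (A₁ᵀ * (A₁ * A₁ᵀ)⁻¹) *ᵥ b₁ = (A₁ * A₂ᵀ)ᵀ *ᵥ (A₁ * A₁ᵀ)⁻¹ *ᵥ b₁ := by
    simp only [transpose_mul, transpose_transpose, mulVec_mulVec, Matrix.mul_assoc]
  rw [hM] at h ⊢
  rw [hW, hx]
  have hsymm : (A₁ * A₁ᵀ).IsSymm := by
    rw [IsSymm, transpose_mul, transpose_transpose]
  exact sumElim_dotProduct_inv_fromBlocks_mulVec hsymm h₁ h b₁ b₂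
end

section
/- (Change of optimal values in least norm optimization.) Let A₁ be an m₁×n and A₂ an m₂×n real matrix, b₁ ∈ ℝ^{m₁}, b₂ ∈ ℝ^{m₂}, and assume A₁A₁ᵀ is invertible and the stacked matrix A (A₁ on top of A₂) satisfies that A Aᵀ is invertible. Let f⋆ be the least value of xᵀx over {x : A₁x = b₁}, let f⋆⋆ be the least value of xᵀx over {x : A₁x = b₁ and A₂x = b₂}, let x₁⋆ := A₁ᵀ(A₁A₁ᵀ)⁻¹b₁ (the minimizer of the first problem) and C := I − A₁ᵀ(A₁A₁ᵀ)⁻¹A₁ (its covariance). Then f⋆⋆ = f⋆ + (A₂ x₁⋆ − b₂)ᵀ [A₂ C A₂ᵀ]⁻¹ (A₂ x₁⋆ − b₂). -/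
open Matrix

/-- A point of `s` orthogonal to all its displacements within `s` attains the least value of
`x ⬝ᵥ x` on `s`. -/
theorem isLeast_dotProduct_self_of_orthogonal {ι : Type*} [Fintype ι] {s : Set (ι → ℝ)}
    {x₀ : ι → ℝ} (hx₀ : x₀ ∈ s) (horth : ∀ x ∈ s, (x - x₀) ⬝ᵥ x₀ = 0) :
    IsLeast ((fun x => x ⬝ᵥ x) '' s) (x₀ ⬝ᵥ x₀) := by
  refine ⟨⟨x₀, hx₀, rfl⟩, ?_⟩
  rintro _ ⟨x, hx, rfl⟩
  have hnonneg : 0 ≤ (x - x₀) ⬝ᵥ (x - x₀) := Finset.sum_nonneg fun i _ => mul_self_nonneg _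
  have hzero := horth x hx
  simp only [sub_dotProduct, dotProduct_sub, dotProduct_comm x₀ x] at hnonneg hzero ⊢
  linarith

/-- The Schur complement of `A₁ * A₁ᵀ` in the Gram matrix of the stacked rows is invertible. -/
theorem isUnit_schur_complement_fromRows {l m n : Type*} [Fintype l] [Fintype m] [Fintype n]
    [DecidableEq l] [DecidableEq m] [DecidableEq n]
    {A₁ : Matrix l n ℝ} {A₂ : Matrix m n ℝ} (h₁ : IsUnit (A₁ * A₁ᵀ))
    (h : IsUnit (fromRows A₁ A₂ * (fromRows A₁ A₂)ᵀ)) :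
    IsUnit (A₂ * (1 - A₁ᵀ * (A₁ * A₁ᵀ)⁻¹ * A₁) * A₂ᵀ) := by
  let _ := h₁.invertible
  rw [transpose_fromRows, fromRows_mul_fromCols, isUnit_fromBlocks_iff_of_invertible₁₁,
    invOf_eq_nonsing_inv] at h
  simpa only [Matrix.mul_sub, Matrix.sub_mul, Matrix.mul_one, Matrix.mul_assoc] using h

/-- Change of optimal values in incremental least norm optimization:
`f⋆⋆ = f⋆ + (A₂ x₁⋆ - b₂)ᵀ [A₂ C A₂ᵀ]⁻¹ (A₂ x₁⋆ - b₂)` where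
`x₁⋆ = A₁ᵀ(A₁A₁ᵀ)⁻¹b₁` and `C = I - A₁ᵀ(A₁A₁ᵀ)⁻¹A₁`. -/
theorem minNorm_change_of_optimal_values {m₁ m₂ n : ℕ}
    (A₁ : Matrix (Fin m₁) (Fin n) ℝ) (A₂ : Matrix (Fin m₂) (Fin n) ℝ)
    (b₁ : Fin m₁ → ℝ) (b₂ : Fin m₂ → ℝ)
    (h₁ : IsUnit (A₁ * A₁ᵀ))
    (h : IsUnit (Matrix.fromRows A₁ A₂ * (Matrix.fromRows A₁ A₂)ᵀ))
    (fstar fstarstar : ℝ)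
    (hf₁ : IsLeast ((fun x => x ⬝ᵥ x) '' {x | A₁.mulVec x = b₁}) fstar)
    (hf₂ : IsLeast ((fun x => x ⬝ᵥ x) ''
        {x | A₁.mulVec x = b₁ ∧ A₂.mulVec x = b₂}) fstarstar) :
    fstarstar = fstar
      + (A₂.mulVec ((A₁ᵀ * (A₁ * A₁ᵀ)⁻¹).mulVec b₁) - b₂) ⬝ᵥ
          ((A₂ * (1 - A₁ᵀ * (A₁ * A₁ᵀ)⁻¹ * A₁) * A₂ᵀ)⁻¹).mulVec
            (A₂.mulVec ((A₁ᵀ * (A₁ * A₁ᵀ)⁻¹).mulVec b₁) - b₂) := by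
  have hS := isUnit_schur_complement_fromRows h₁ h
  have hGdet := (isUnit_iff_isUnit_det _).mp h₁
  set P := A₁ᵀ * (A₁ * A₁ᵀ)⁻¹ with hP
  set C := 1 - P * A₁ with hC
  set S := A₂ * C * A₂ᵀ with hSdef
  have hSdet := (isUnit_iff_isUnit_det _).mp hS
  have hAP : A₁ * P = 1 := by
    rw [hP, ← Matrix.mul_assoc, mul_nonsing_inv _ hGdet]
  have hAC : A₁ * C = 0 := by
    rw [hC, Matrix.mul_sub, ← Matrix.mul_assoc, hAP, Matrix.mul_one, Matrix.one_mul, sub_self]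
  have hCt : Cᵀ = C := by
    simp [hC, hP, transpose_nonsing_inv, Matrix.mul_assoc]
  have hCC : C * C = C := by
    nth_rewrite 1 [hC]
    rw [Matrix.sub_mul, Matrix.mul_assoc, hAC, Matrix.mul_zero, Matrix.one_mul, sub_zero]
  have hdotP (d : Fin n → ℝ) (hd : A₁ *ᵥ d = 0) : d ⬝ᵥ P *ᵥ b₁ = 0 := by
    rw [hP, ← mulVec_mulVec, dotProduct_mulVec, vecMul_transpose, hd, zero_dotProduct]
  have hx₁ : A₁ *ᵥ P *ᵥ b₁ = b₁ := by rw [mulVec_mulVec, hAP, one_mulVec]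
  set x₁ := P *ᵥ b₁ with hx₁def
  set r := A₂ *ᵥ x₁ - b₂ with hr
  set w := S⁻¹ *ᵥ r with hw
  have hSw : S *ᵥ w = r := by rw [hw, mulVec_mulVec, mul_nonsing_inv _ hSdet, one_mulVec]
  set v := C *ᵥ A₂ᵀ *ᵥ w with hv
  have hAv : A₁ *ᵥ v = 0 := by rw [hv, mulVec_mulVec, hAC, zero_mulVec]
  have hAv₂ : A₂ *ᵥ v = r := by
    rw [hv, mulVec_mulVec, mulVec_mulVec, ← hSdef, hSw]
  have hdotv (d : Fin n → ℝ) (hd : A₁ *ᵥ d = 0) : d ⬝ᵥ v = A₂ *ᵥ d ⬝ᵥ w := by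
    have hCd : C *ᵥ d = d := by
      rw [hC, sub_mulVec, ← mulVec_mulVec, hd, mulVec_zero, one_mulVec, sub_zero]
    rw [hv, dotProduct_mulVec, ← mulVec_transpose, hCt, hCd, dotProduct_mulVec, vecMul_transpose]
  have hmin₁ : IsLeast ((fun x => x ⬝ᵥ x) '' {x | A₁ *ᵥ x = b₁}) (x₁ ⬝ᵥ x₁) := by
    refine isLeast_dotProduct_self_of_orthogonal hx₁ fun x (hx : A₁ *ᵥ x = b₁) => hdotP _ ?_
    rw [mulVec_sub, hx, hx₁, sub_self]
  have hmin₂ : IsLeast ((fun x => x ⬝ᵥ x) '' {x | A₁ *ᵥ x = b₁ ∧ A₂ *ᵥ x = b₂})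
      ((x₁ - v) ⬝ᵥ (x₁ - v)) := by
    have hfeas₁ : A₁ *ᵥ (x₁ - v) = b₁ := by rw [mulVec_sub, hx₁, hAv, sub_zero]
    have hfeas₂ : A₂ *ᵥ (x₁ - v) = b₂ := by rw [mulVec_sub, hAv₂, hr, sub_sub_cancel]
    refine isLeast_dotProduct_self_of_orthogonal ⟨hfeas₁, hfeas₂⟩ ?_
    rintro x ⟨hx, hx'⟩
    have hd : A₁ *ᵥ (x - (x₁ - v)) = 0 := by rw [mulVec_sub, hx, hfeas₁, sub_self]
    have hd' : A₂ *ᵥ (x - (x₁ - v)) = 0 := by rw [mulVec_sub, hx', hfeas₂, sub_self]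
    rw [dotProduct_sub _ x₁ v, hdotP _ hd, hdotv _ hd, hd', zero_dotProduct, sub_zero]
  rw [hf₁.unique hmin₁, hf₂.unique hmin₂, ← hAv₂, ← hdotv v hAv]
  have hvx := hdotP v hAv
  simp only [sub_dotProduct, dotProduct_sub, dotProduct_comm x₁ v, hvx]
  ring
end

section
/- (Monotonicity and exactness of the increment.) Under the hypotheses that A₁A₁ᵀ is invertible and the stacked matrix A (A₁ on top of A₂) satisfies that A Aᵀ is invertible, with x₁⋆ := A₁ᵀ(A₁A₁ᵀ)⁻¹b₁, f⋆ the least value of xᵀx over {x : A₁x = b₁}, and f⋆⋆ the least value of xᵀx over {x : A₁x = b₁ and A₂x = b₂}: one has f⋆⋆ ≥ f⋆, with f⋆⋆ = f⋆ if and only if A₂ x₁⋆ = b₂. -/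
open Matrix

theorem mulVec_transpose_mul_inv_mulVec {m n R : Type*} [Fintype m] [DecidableEq m] [Fintype n]
    [CommRing R] {A : Matrix m n R} (hA : IsUnit (A * Aᵀ)) (b : m → R) :
    A *ᵥ ((Aᵀ * (A * Aᵀ)⁻¹) *ᵥ b) = b := by
  rw [mulVec_mulVec, ← Matrix.mul_assoc,
    mul_nonsing_inv _ ((isUnit_iff_isUnit_det _).mp hA), one_mulVec]

theorem dotProduct_self_eq_add_of_mulVec_eq {m n R : Type*} [Fintype m] [DecidableEq m]
    [Fintype n] [CommRing R] {A : Matrix m n R} (hA : IsUnit (A * Aᵀ)) {b : m → R} {x : n → R}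
    (hx : A *ᵥ x = b) :
    x ⬝ᵥ x = ((Aᵀ * (A * Aᵀ)⁻¹) *ᵥ b) ⬝ᵥ ((Aᵀ * (A * Aᵀ)⁻¹) *ᵥ b) +
      (x - (Aᵀ * (A * Aᵀ)⁻¹) *ᵥ b) ⬝ᵥ (x - (Aᵀ * (A * Aᵀ)⁻¹) *ᵥ b) := by
  have horth : (x - (Aᵀ * (A * Aᵀ)⁻¹) *ᵥ b) ⬝ᵥ ((Aᵀ * (A * Aᵀ)⁻¹) *ᵥ b) = 0 := by
    conv_lhs => rw [← mulVec_mulVec, dotProduct_mulVec, vecMul_transpose, mulVec_mulVec,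
      mulVec_sub, mulVec_transpose_mul_inv_mulVec hA, hx, sub_self, zero_dotProduct]
  generalize (Aᵀ * (A * Aᵀ)⁻¹) *ᵥ b = y at horth ⊢
  simp only [sub_dotProduct, dotProduct_sub, dotProduct_comm y x] at horth ⊢
  linear_combination 2 * horth

theorem eq_of_mulVec_eq_of_dotProduct_self_le {m n : Type*} [Fintype m] [DecidableEq m]
    [Fintype n] {A : Matrix m n ℝ} (hA : IsUnit (A * Aᵀ)) {b : m → ℝ} {x : n → ℝ}
    (hx : A *ᵥ x = b)
    (hle : x ⬝ᵥ x ≤ ((Aᵀ * (A * Aᵀ)⁻¹) *ᵥ b) ⬝ᵥ ((Aᵀ * (A * Aᵀ)⁻¹) *ᵥ b)) :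
    x = (Aᵀ * (A * Aᵀ)⁻¹) *ᵥ b := by
  have hdec := dotProduct_self_eq_add_of_mulVec_eq hA hx
  have hnonneg : 0 ≤ (x - (Aᵀ * (A * Aᵀ)⁻¹) *ᵥ b) ⬝ᵥ (x - (Aᵀ * (A * Aᵀ)⁻¹) *ᵥ b) :=
    Finset.sum_nonneg fun _ _ => mul_self_nonneg _
  exact sub_eq_zero.mp (dotProduct_self_eq_zero.mp (by linarith))

/-- Monotonicity and exactness of the increment of optimal values in
incremental least norm optimization: `f⋆⋆ ≥ f⋆`, with equality iff the new
constraint is already satisfied by the previous minimizer `x₁⋆`. -/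
theorem minNorm_increment_nonneg_and_exact {m₁ m₂ n : ℕ}
    (A₁ : Matrix (Fin m₁) (Fin n) ℝ) (A₂ : Matrix (Fin m₂) (Fin n) ℝ)
    (b₁ : Fin m₁ → ℝ) (b₂ : Fin m₂ → ℝ)
    (h₁ : IsUnit (A₁ * A₁ᵀ))
    (h : IsUnit (Matrix.fromRows A₁ A₂ * (Matrix.fromRows A₁ A₂)ᵀ))
    (fstar fstarstar : ℝ)
    (hf₁ : IsLeast ((fun x => x ⬝ᵥ x) '' {x | A₁.mulVec x = b₁}) fstar)
    (hf₂ : IsLeast ((fun x => x ⬝ᵥ x) ''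
        {x | A₁.mulVec x = b₁ ∧ A₂.mulVec x = b₂}) fstarstar) :
    fstarstar ≥ fstar ∧
    (fstarstar = fstar ↔ A₂.mulVec ((A₁ᵀ * (A₁ * A₁ᵀ)⁻¹).mulVec b₁) = b₂) := by
  obtain ⟨⟨u, hu, rfl⟩, hmin₁⟩ := hf₁
  obtain ⟨⟨v, ⟨hv₁, hv₂⟩, rfl⟩, hmin₂⟩ := hf₂
  have hx := mulVec_transpose_mul_inv_mulVec h₁ b₁
  have hle := hmin₁ ⟨v, hv₁, rfl⟩
  refine ⟨hle, fun heq => ?_, fun hx₂ => le_antisymm ?_ hle⟩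
  · have hvx := heq.trans_le (hmin₁ ⟨_, hx, rfl⟩)
    rw [← eq_of_mulVec_eq_of_dotProduct_self_le h₁ hv₁ hvx, hv₂]
  · have hux := eq_of_mulVec_eq_of_dotProduct_self_le h₁ hu (hmin₁ ⟨_, hx, rfl⟩)
    exact hmin₂ ⟨u, ⟨hu, hux ▸ hx₂⟩, rfl⟩
end

section
/- (Weighted generalization of the main identity.) Let Q be a positive definite n×n real matrix, A₁ an m₁×n and A₂ an m₂×n real matrix, b₁ ∈ ℝ^{m₁}, b₂ ∈ ℝ^{m₂}, with A the stacked matrix (A₁ on top of A₂) and b the stacked vector (b₁ on top of b₂). Assume A₁ Q A₁ᵀ and A Q Aᵀ are invertible. Set x₁⋆ := Q A₁ᵀ (A₁ Q A₁ᵀ)⁻¹ b₁ and C := Q − Q A₁ᵀ (A₁ Q A₁ᵀ)⁻¹ A₁ Q. Then bᵀ (A Q Aᵀ)⁻¹ b = b₁ᵀ (A₁ Q A₁ᵀ)⁻¹ b₁ + (A₂ x₁⋆ − b₂)ᵀ [A₂ C A₂ᵀ]⁻¹ (A₂ x₁⋆ − b₂). -/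
open Matrix

/-- Schur complement formula for the quadratic form of the inverse of a symmetric block matrix. -/
theorem Matrix.dotProduct_inv_fromBlocks_mulVec {m n R : Type*} [Fintype m] [Fintype n]
    [DecidableEq m] [DecidableEq n] [CommRing R] {P : Matrix m m R} (B : Matrix m n R)
    (D : Matrix n n R) (u : m → R) (v : n → R) (hsymm : P.IsSymm) (hP : IsUnit P)
    (hS : IsUnit (fromBlocks P B Bᵀ D)) :
    Sum.elim u v ⬝ᵥ (fromBlocks P B Bᵀ D)⁻¹ *ᵥ Sum.elim u v =
      u ⬝ᵥ P⁻¹ *ᵥ u + (Bᵀ *ᵥ P⁻¹ *ᵥ u - v) ⬝ᵥ (D - Bᵀ * P⁻¹ * B)⁻¹ *ᵥ (Bᵀ *ᵥ P⁻¹ *ᵥ u - v) := by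
  have hK : IsUnit (D - Bᵀ * P⁻¹ * B) := by
    let _ := hP.invertible
    rw [← invOf_eq_nonsing_inv]
    exact isUnit_fromBlocks_iff_of_invertible₁₁.mp hS
  have hPP : P * P⁻¹ = 1 := mul_nonsing_inv _ ((isUnit_iff_isUnit_det _).mp hP)
  have hKK := mul_nonsing_inv _ ((isUnit_iff_isUnit_det _).mp hK)
  have hSS := nonsing_inv_mul _ ((isUnit_iff_isUnit_det _).mp hS)
  set K := D - Bᵀ * P⁻¹ * B with hKdef
  set w := Bᵀ *ᵥ P⁻¹ *ᵥ u - v with hw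
  set z := K⁻¹ *ᵥ w with hz
  have hKz : D *ᵥ z - Bᵀ *ᵥ P⁻¹ *ᵥ B *ᵥ z = w := by
    have : K *ᵥ z = w := by rw [hz, mulVec_mulVec, hKK, one_mulVec]
    rwa [hKdef, sub_mulVec, ← mulVec_mulVec, ← mulVec_mulVec] at this
  have hsol : fromBlocks P B Bᵀ D *ᵥ Sum.elim (P⁻¹ *ᵥ u + P⁻¹ *ᵥ B *ᵥ z) (-z) =
      Sum.elim u v := by
    rw [fromBlocks_mulVec]
    simp only [Sum.elim_comp_inl, Sum.elim_comp_inr]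
    congr 1
    · rw [mulVec_add, mulVec_mulVec, mulVec_mulVec _ P, hPP, one_mulVec, one_mulVec, mulVec_neg]
      abel
    · rw [mulVec_add, mulVec_neg]
      have hv : v = Bᵀ *ᵥ P⁻¹ *ᵥ u - w := by rw [hw]; abel
      rw [hv, ← hKz]
      abel
  have hinv : (fromBlocks P B Bᵀ D)⁻¹ *ᵥ Sum.elim u v =
      Sum.elim (P⁻¹ *ᵥ u + P⁻¹ *ᵥ B *ᵥ z) (-z) := by
    rw [← hsol, mulVec_mulVec, hSS, one_mulVec]
  have hcross : u ⬝ᵥ P⁻¹ *ᵥ B *ᵥ z = (Bᵀ *ᵥ P⁻¹ *ᵥ u) ⬝ᵥ z := by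
    rw [dotProduct_mulVec, dotProduct_mulVec, mulVec_transpose, ← mulVec_transpose P⁻¹,
      transpose_nonsing_inv, hsymm.eq]
  rw [hinv, sumElim_dotProduct_sumElim, dotProduct_add, hcross, hw, sub_dotProduct,
    dotProduct_neg]
  ring

/-- Weighted generalization of the main identity, with weight matrix `Q`
positive definite:
`bᵀ (A Q Aᵀ)⁻¹ b = b₁ᵀ (A₁ Q A₁ᵀ)⁻¹ b₁ + (A₂ x₁⋆ - b₂)ᵀ [A₂ C A₂ᵀ]⁻¹ (A₂ x₁⋆ - b₂)`
where `x₁⋆ = Q A₁ᵀ (A₁ Q A₁ᵀ)⁻¹ b₁` and `C = Q - Q A₁ᵀ (A₁ Q A₁ᵀ)⁻¹ A₁ Q`. -/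
theorem weighted_optimal_value_decomposition {m₁ m₂ n : ℕ}
    (Q : Matrix (Fin n) (Fin n) ℝ) (hQ : Q.PosDef)
    (A₁ : Matrix (Fin m₁) (Fin n) ℝ) (A₂ : Matrix (Fin m₂) (Fin n) ℝ)
    (b₁ : Fin m₁ → ℝ) (b₂ : Fin m₂ → ℝ)
    (h₁ : IsUnit (A₁ * Q * A₁ᵀ))
    (h : IsUnit (Matrix.fromRows A₁ A₂ * Q * (Matrix.fromRows A₁ A₂)ᵀ)) :
    (Sum.elim b₁ b₂) ⬝ᵥ
        ((Matrix.fromRows A₁ A₂ * Q * (Matrix.fromRows A₁ A₂)ᵀ)⁻¹).mulVec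
          (Sum.elim b₁ b₂)
      = b₁ ⬝ᵥ ((A₁ * Q * A₁ᵀ)⁻¹).mulVec b₁
        + (A₂.mulVec ((Q * A₁ᵀ * (A₁ * Q * A₁ᵀ)⁻¹).mulVec b₁) - b₂) ⬝ᵥ
            ((A₂ * (Q - Q * A₁ᵀ * (A₁ * Q * A₁ᵀ)⁻¹ * A₁ * Q) * A₂ᵀ)⁻¹).mulVec
              (A₂.mulVec ((Q * A₁ᵀ * (A₁ * Q * A₁ᵀ)⁻¹).mulVec b₁) - b₂) := by
  have hQs : Qᵀ = Q := by simpa using hQ.isHermitian.eq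
  have hBt : (A₁ * Q * A₂ᵀ)ᵀ = A₂ * Q * A₁ᵀ := by
    simp only [transpose_mul, transpose_transpose, hQs, Matrix.mul_assoc]
  have hsymm : (A₁ * Q * A₁ᵀ).IsSymm := by
    simp only [IsSymm, transpose_mul, transpose_transpose, hQs, Matrix.mul_assoc]
  have hblocks : fromRows A₁ A₂ * Q * (fromRows A₁ A₂)ᵀ =
      fromBlocks (A₁ * Q * A₁ᵀ) (A₁ * Q * A₂ᵀ) (A₁ * Q * A₂ᵀ)ᵀ (A₂ * Q * A₂ᵀ) := by
    rw [hBt, transpose_fromRows, fromRows_mul, fromRows_mul_fromCols]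
  rw [hblocks] at h ⊢
  rw [dotProduct_inv_fromBlocks_mulVec _ _ _ _ hsymm h₁ h, hBt]
  simp only [mulVec_mulVec, Matrix.mul_sub, Matrix.sub_mul, Matrix.mul_assoc]
end

section
/- (Least distance optimization: minimizer and optimal value.) Let H be an invertible n×n real matrix, Σ a positive definite n×n real matrix, h ∈ ℝⁿ, A an m×n real matrix, b ∈ ℝ^m. Set Q := H⁻¹ Σ H⁻ᵀ and assume A Q Aᵀ is invertible. Then x⋆ := H⁻¹h + Q Aᵀ (A Q Aᵀ)⁻¹ (b − A H⁻¹ h) satisfies A x⋆ = b, and the least value of (H x − h)ᵀ Σ⁻¹ (H x − h) over {x ∈ ℝⁿ : A x = b} equals (b − A H⁻¹ h)ᵀ (A Q Aᵀ)⁻¹ (b − A H⁻¹ h), attained at x⋆. -/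
open Matrix

/-- If `y` has the same inner product with `u` as with itself, with respect to a positive
semidefinite form, then the form at `y` is at most the form at `u`. -/
lemma Matrix.PosSemidef.dotProduct_mulVec_le_of_eq {ι : Type*} [Fintype ι] {S : Matrix ι ι ℝ}
    (hS : S.PosSemidef) {u y : ι → ℝ} (huy : u ⬝ᵥ S *ᵥ y = y ⬝ᵥ S *ᵥ y) :
    y ⬝ᵥ S *ᵥ y ≤ u ⬝ᵥ S *ᵥ u := by
  have hT : Sᵀ = S := by simpa using hS.isHermitian.eq
  have hsymm : y ⬝ᵥ S *ᵥ u = u ⬝ᵥ S *ᵥ y := by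
    rw [dotProduct_mulVec, ← mulVec_transpose, hT, dotProduct_comm]
  have hnonneg : 0 ≤ (u - y) ⬝ᵥ S *ᵥ (u - y) := by
    simpa using hS.dotProduct_mulVec_nonneg (u - y)
  rw [mulVec_sub, sub_dotProduct, dotProduct_sub, dotProduct_sub, hsymm] at hnonneg
  linarith

/-- Least distance optimization: with `Q := H⁻¹ Σ H⁻ᵀ`, the point
`x⋆ := H⁻¹h + Q Aᵀ (A Q Aᵀ)⁻¹ (b - A H⁻¹ h)` is feasible and the least value
of `(H x - h)ᵀ Σ⁻¹ (H x - h)` over `{x : A x = b}` equals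
`(b - A H⁻¹ h)ᵀ (A Q Aᵀ)⁻¹ (b - A H⁻¹ h)`, attained at `x⋆`. -/
theorem leastDistance_optimal_value {m n : ℕ}
    (H Sig : Matrix (Fin n) (Fin n) ℝ)
    (hH : IsUnit H) (hSig : Sig.PosDef)
    (h : Fin n → ℝ)
    (A : Matrix (Fin m) (Fin n) ℝ) (b : Fin m → ℝ)
    (hAQ : IsUnit (A * (H⁻¹ * Sig * Hᵀ⁻¹) * Aᵀ)) :
    A.mulVec (H⁻¹.mulVec h +
        ((H⁻¹ * Sig * Hᵀ⁻¹) * Aᵀ * (A * (H⁻¹ * Sig * Hᵀ⁻¹) * Aᵀ)⁻¹).mulVec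
          (b - A.mulVec (H⁻¹.mulVec h))) = b ∧
    (fun x => (H.mulVec x - h) ⬝ᵥ Sig⁻¹.mulVec (H.mulVec x - h))
        (H⁻¹.mulVec h +
          ((H⁻¹ * Sig * Hᵀ⁻¹) * Aᵀ * (A * (H⁻¹ * Sig * Hᵀ⁻¹) * Aᵀ)⁻¹).mulVec
            (b - A.mulVec (H⁻¹.mulVec h)))
      = (b - A.mulVec (H⁻¹.mulVec h)) ⬝ᵥ
          ((A * (H⁻¹ * Sig * Hᵀ⁻¹) * Aᵀ)⁻¹).mulVec (b - A.mulVec (H⁻¹.mulVec h)) ∧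
    IsLeast
      ((fun x => (H.mulVec x - h) ⬝ᵥ Sig⁻¹.mulVec (H.mulVec x - h)) ''
        {x | A.mulVec x = b})
      ((b - A.mulVec (H⁻¹.mulVec h)) ⬝ᵥ
        ((A * (H⁻¹ * Sig * Hᵀ⁻¹) * Aᵀ)⁻¹).mulVec (b - A.mulVec (H⁻¹.mulVec h))) := by
  set r := b - A *ᵥ (H⁻¹ *ᵥ h) with hr
  set M := A * (H⁻¹ * Sig * Hᵀ⁻¹) * Aᵀ with hM
  set x₀ := H⁻¹ *ᵥ h + ((H⁻¹ * Sig * Hᵀ⁻¹) * Aᵀ * M⁻¹) *ᵥ r with hx₀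
  have hHdet := (isUnit_iff_isUnit_det H).1 hH
  have hSdet := (isUnit_iff_isUnit_det Sig).1 hSig.isUnit
  have hMdet := (isUnit_iff_isUnit_det M).1 hAQ
  have hfeas : A *ᵥ x₀ = b := by
    have hAM : A * ((H⁻¹ * Sig * Hᵀ⁻¹) * Aᵀ * M⁻¹) = 1 := by
      rw [← Matrix.mul_assoc, ← Matrix.mul_assoc, ← hM, mul_nonsing_inv M hMdet]
    rw [hx₀, mulVec_add, mulVec_mulVec r, hAM, one_mulVec, hr, add_sub_cancel]
  have hresidual : Sig⁻¹ *ᵥ (H *ᵥ x₀ - h) = (A * H⁻¹)ᵀ *ᵥ (M⁻¹ *ᵥ r) := by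
    have hmat : Sig⁻¹ * (H * ((H⁻¹ * Sig * Hᵀ⁻¹) * Aᵀ * M⁻¹)) = (A * H⁻¹)ᵀ * M⁻¹ := by
      simp only [Matrix.mul_assoc, transpose_mul, transpose_nonsing_inv]
      rw [mul_nonsing_inv_cancel_left _ _ hHdet, nonsing_inv_mul_cancel_left _ _ hSdet]
    rw [hx₀, mulVec_add, mulVec_mulVec h, mul_nonsing_inv H hHdet, one_mulVec,
      add_sub_cancel_left, mulVec_mulVec, mulVec_mulVec, Matrix.mul_assoc, hmat, mulVec_mulVec]
  have hinner : ∀ x, A *ᵥ x = b →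
      (H *ᵥ x - h) ⬝ᵥ Sig⁻¹ *ᵥ (H *ᵥ x₀ - h) = r ⬝ᵥ M⁻¹ *ᵥ r := by
    intro x hx
    rw [hresidual, dotProduct_mulVec, vecMul_transpose, mulVec_sub, mulVec_mulVec,
      nonsing_inv_mul_cancel_right _ _ hHdet, hx, ← mulVec_mulVec]
  refine ⟨hfeas, hinner x₀ hfeas, ⟨x₀, hfeas, hinner x₀ hfeas⟩, ?_⟩
  rintro _ ⟨x, hx, rfl⟩
  rw [← hinner x₀ hfeas]
  exact hSig.inv.posSemidef.dotProduct_mulVec_le_of_eq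
    ((hinner x hx).trans (hinner x₀ hfeas).symm)
end

section
/- (Change of optimal values in least distance optimization, Eq. (12).) Let H be an invertible n×n real matrix, Σ a positive definite n×n real matrix, h ∈ ℝⁿ; let A₁ be an m₁×n and A₂ an m₂×n real matrix, b₁ ∈ ℝ^{m₁}, b₂ ∈ ℝ^{m₂}, and let A be the stacked matrix (A₁ on top of A₂) and b the stacked vector. Set Q := H⁻¹ Σ H⁻ᵀ and assume A₁ Q A₁ᵀ and A Q Aᵀ are invertible. Let f⋆ be the least value of (H x − h)ᵀ Σ⁻¹ (H x − h) over {x : A₁ x = b₁}, f⋆⋆ the least value over {x : A₁ x = b₁ and A₂ x = b₂}, x₁⋆ := H⁻¹h + Q A₁ᵀ (A₁ Q A₁ᵀ)⁻¹ (b₁ − A₁ H⁻¹ h) the minimizer of the first problem, and C := Q − Q A₁ᵀ (A₁ Q A₁ᵀ)⁻¹ A₁ Q its covariance. Then f⋆⋆ = f⋆ + (A₂ x₁⋆ − b₂)ᵀ [A₂ C A₂ᵀ]⁻¹ (A₂ x₁⋆ − b₂). -/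
open Matrix

section LeastDistance

variable {ι κ₁ κ₂ : Type*} [Fintype ι] [Fintype κ₁] [DecidableEq κ₁]
  [Fintype κ₂] [DecidableEq κ₂]

theorem dotProduct_mulVec_add_self_of_isHermitian {P : Matrix ι ι ℝ} (hP : P.IsHermitian)
    (u v : ι → ℝ) :
    (u + v) ⬝ᵥ P *ᵥ (u + v) = u ⬝ᵥ P *ᵥ u + 2 * (v ⬝ᵥ P *ᵥ u) + v ⬝ᵥ P *ᵥ v := by
  have hsymm : u ⬝ᵥ P *ᵥ v = v ⬝ᵥ P *ᵥ u := by
    have hPt : Pᵀ = P := by simpa using hP.eq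
    rw [dotProduct_mulVec, ← mulVec_transpose, hPt, dotProduct_comm]
  rw [mulVec_add, dotProduct_add, add_dotProduct, add_dotProduct, hsymm]
  ring

/-- A feasible point at which the gradient of a convex quadratic form is orthogonal to all
feasible directions is a minimizer. -/
theorem isLeast_quadratic_image {P : Matrix ι ι ℝ} (hP : P.PosSemidef) (c : ι → ℝ)
    {s : Set (ι → ℝ)} {y : ι → ℝ} (hy : y ∈ s)
    (horth : ∀ x ∈ s, (x - y) ⬝ᵥ P *ᵥ (y - c) = 0) :
    IsLeast ((fun x => (x - c) ⬝ᵥ P *ᵥ (x - c)) '' s) ((y - c) ⬝ᵥ P *ᵥ (y - c)) := by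
  refine ⟨⟨y, hy, rfl⟩, ?_⟩
  rintro _ ⟨x, hx, rfl⟩
  have hsplit : x - c = (y - c) + (x - y) := by abel
  have hnonneg : 0 ≤ (x - y) ⬝ᵥ P *ᵥ (x - y) := by
    simpa using hP.dotProduct_mulVec_nonneg (x - y)
  beta_reduce
  rw [hsplit, dotProduct_mulVec_add_self_of_isHermitian hP.isHermitian, horth x hx]
  linarith

theorem isUnit_schur_of_isUnit_fromRows {Q : Matrix ι ι ℝ} {A₁ : Matrix κ₁ ι ℝ}
    {A₂ : Matrix κ₂ ι ℝ} (h₁ : IsUnit (A₁ * Q * A₁ᵀ))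
    (hA : IsUnit (fromRows A₁ A₂ * Q * (fromRows A₁ A₂)ᵀ)) :
    IsUnit (A₂ * (Q - Q * A₁ᵀ * (A₁ * Q * A₁ᵀ)⁻¹ * A₁ * Q) * A₂ᵀ) := by
  rw [transpose_fromRows, fromRows_mul, fromRows_mul_fromCols] at hA
  let := h₁.invertible
  rw [isUnit_fromBlocks_iff_of_invertible₁₁, invOf_eq_nonsing_inv] at hA
  simpa only [Matrix.mul_sub, Matrix.sub_mul, Matrix.mul_assoc] using hA

/-- Change of the optimal value of a positive semidefinite quadratic form with invertible
matrix when the constraints `A₂ x = b₂` are added to `A₁ x = b₁`. -/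
theorem quadratic_change_of_optimal_values [DecidableEq ι] {P Q : Matrix ι ι ℝ} (hP : P.PosSemidef)
    (hPQ : P * Q = 1) (c : ι → ℝ) {A₁ : Matrix κ₁ ι ℝ} {A₂ : Matrix κ₂ ι ℝ}
    {b₁ : κ₁ → ℝ} {b₂ : κ₂ → ℝ} (h₁ : IsUnit (A₁ * Q * A₁ᵀ))
    (hA : IsUnit (fromRows A₁ A₂ * Q * (fromRows A₁ A₂)ᵀ)) {f₁ f₂ : ℝ}
    (hf₁ : IsLeast ((fun x => (x - c) ⬝ᵥ P *ᵥ (x - c)) '' {x | A₁ *ᵥ x = b₁}) f₁)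
    (hf₂ : IsLeast ((fun x => (x - c) ⬝ᵥ P *ᵥ (x - c)) ''
      {x | A₁ *ᵥ x = b₁ ∧ A₂ *ᵥ x = b₂}) f₂)
    {x₁ : ι → ℝ}
    (hx₁ : x₁ = c + (Q * A₁ᵀ * (A₁ * Q * A₁ᵀ)⁻¹) *ᵥ (b₁ - A₁ *ᵥ c)) :
    f₂ = f₁ + (A₂ *ᵥ x₁ - b₂) ⬝ᵥ
      (A₂ * (Q - Q * A₁ᵀ * (A₁ * Q * A₁ᵀ)⁻¹ * A₁ * Q) * A₂ᵀ)⁻¹ *ᵥ (A₂ *ᵥ x₁ - b₂) := by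
  have hS := isUnit_schur_of_isUnit_fromRows h₁ hA
  rw [isUnit_iff_isUnit_det] at h₁ hS
  have hG := mul_nonsing_inv _ h₁
  set G := A₁ * Q * A₁ᵀ with hGdef
  set C := Q - Q * A₁ᵀ * G⁻¹ * A₁ * Q with hC
  set S := A₂ * C * A₂ᵀ with hSdef
  have hAC : A₁ * C = 0 := by
    have : A₁ * (Q * A₁ᵀ * G⁻¹ * A₁ * Q) = (G * G⁻¹) * (A₁ * Q) := by
      rw [hGdef]; simp only [Matrix.mul_assoc]
    rw [hC, Matrix.mul_sub, this, hG, Matrix.one_mul, sub_self]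
  have hPC : P * C = 1 - A₁ᵀ * (G⁻¹ * A₁ * Q) := by
    have : P * (Q * A₁ᵀ * G⁻¹ * A₁ * Q) = (P * Q) * (A₁ᵀ * (G⁻¹ * A₁ * Q)) := by
      simp only [Matrix.mul_assoc]
    rw [hC, Matrix.mul_sub, this, hPQ, Matrix.one_mul]
  have hfeas : A₁ *ᵥ x₁ = b₁ := by
    have : A₁ * (Q * A₁ᵀ * G⁻¹) = 1 := by rw [← hG, hGdef]; simp only [Matrix.mul_assoc]
    rw [hx₁, mulVec_add, mulVec_mulVec, this, one_mulVec, add_sub_cancel]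
  have hgrad : P *ᵥ (x₁ - c) = A₁ᵀ *ᵥ (G⁻¹ *ᵥ (b₁ - A₁ *ᵥ c)) := by
    have : P * (Q * A₁ᵀ * G⁻¹) = A₁ᵀ * G⁻¹ := by
      rw [Matrix.mul_assoc Q, ← Matrix.mul_assoc P, hPQ, Matrix.one_mul]
    rw [hx₁, add_sub_cancel_left, mulVec_mulVec, this, mulVec_mulVec]
  have horth₁ : ∀ z, A₁ *ᵥ z = 0 → z ⬝ᵥ P *ᵥ (x₁ - c) = 0 := fun z hz => by
    rw [hgrad, dotProduct_mulVec, vecMul_transpose, hz, zero_dotProduct]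
  set w := b₂ - A₂ *ᵥ x₁ with hw
  set d := C *ᵥ (A₂ᵀ *ᵥ (S⁻¹ *ᵥ w)) with hd
  have hA₁d : A₁ *ᵥ d = 0 := by rw [hd, mulVec_mulVec, hAC, zero_mulVec]
  have hA₂d : A₂ *ᵥ d = w := by
    rw [hd, mulVec_mulVec, mulVec_mulVec, mulVec_mulVec, ← hSdef, mul_nonsing_inv _ hS,
      one_mulVec]
  have hPd : ∀ z, A₁ *ᵥ z = 0 → z ⬝ᵥ P *ᵥ d = (A₂ *ᵥ z) ⬝ᵥ S⁻¹ *ᵥ w := fun z hz => by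
    rw [hd, mulVec_mulVec, hPC, sub_mulVec, one_mulVec, dotProduct_sub, ← mulVec_mulVec,
      dotProduct_mulVec z A₁ᵀ, vecMul_transpose, hz, zero_dotProduct, sub_zero,
      dotProduct_mulVec, vecMul_transpose]
  have hleast₁ := isLeast_quadratic_image hP c (s := {x | A₁ *ᵥ x = b₁}) hfeas
    fun x hx => horth₁ _ (by rw [mulVec_sub, hfeas, Set.mem_ofPred.mp hx, sub_self])
  have hfeas₂ : A₂ *ᵥ (x₁ + d) = b₂ := by rw [mulVec_add, hA₂d, hw, add_sub_cancel]
  have hfeas₁ : A₁ *ᵥ (x₁ + d) = b₁ := by rw [mulVec_add, hA₁d, add_zero, hfeas]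
  have hsplit : x₁ + d - c = (x₁ - c) + d := by abel
  have hleast₂ := isLeast_quadratic_image hP c
    (s := {x | A₁ *ᵥ x = b₁ ∧ A₂ *ᵥ x = b₂}) ⟨hfeas₁, hfeas₂⟩ fun x hx => by
      have hz₁ : A₁ *ᵥ (x - (x₁ + d)) = 0 := by rw [mulVec_sub, hfeas₁, hx.1, sub_self]
      have hz₂ : A₂ *ᵥ (x - (x₁ + d)) = 0 := by rw [mulVec_sub, hfeas₂, hx.2, sub_self]
      rw [hsplit, mulVec_add, dotProduct_add, horth₁ _ hz₁, hPd _ hz₁, hz₂, zero_dotProduct,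
        add_zero]
  have hneg : A₂ *ᵥ x₁ - b₂ = -w := by rw [hw, neg_sub]
  rw [hf₂.unique hleast₂, hf₁.unique hleast₁, hsplit,
    dotProduct_mulVec_add_self_of_isHermitian hP.isHermitian, horth₁ d hA₁d, hPd d hA₁d, hA₂d,
    hneg, mulVec_neg, neg_dotProduct_neg, mul_zero, add_zero]

end LeastDistance

/-- Change of optimal values in incremental least distance optimization
(Eq. (12) of the paper): `f⋆⋆ = f⋆ + (A₂ x₁⋆ - b₂)ᵀ [A₂ C A₂ᵀ]⁻¹ (A₂ x₁⋆ - b₂)`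
with `x₁⋆` the minimizer of the first problem and
`C = Q - Q A₁ᵀ (A₁ Q A₁ᵀ)⁻¹ A₁ Q` its covariance, `Q = H⁻¹ Σ H⁻ᵀ`. -/
theorem leastDistance_change_of_optimal_values {m₁ m₂ n : ℕ}
    (H Sig : Matrix (Fin n) (Fin n) ℝ)
    (hH : IsUnit H) (hSig : Sig.PosDef)
    (h : Fin n → ℝ)
    (A₁ : Matrix (Fin m₁) (Fin n) ℝ) (A₂ : Matrix (Fin m₂) (Fin n) ℝ)
    (b₁ : Fin m₁ → ℝ) (b₂ : Fin m₂ → ℝ)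
    (h₁ : IsUnit (A₁ * (H⁻¹ * Sig * Hᵀ⁻¹) * A₁ᵀ))
    (hA : IsUnit (Matrix.fromRows A₁ A₂ * (H⁻¹ * Sig * Hᵀ⁻¹) *
      (Matrix.fromRows A₁ A₂)ᵀ))
    (fstar fstarstar : ℝ)
    (hf₁ : IsLeast
      ((fun x => (H.mulVec x - h) ⬝ᵥ Sig⁻¹.mulVec (H.mulVec x - h)) ''
        {x | A₁.mulVec x = b₁}) fstar)
    (hf₂ : IsLeast
      ((fun x => (H.mulVec x - h) ⬝ᵥ Sig⁻¹.mulVec (H.mulVec x - h)) ''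
        {x | A₁.mulVec x = b₁ ∧ A₂.mulVec x = b₂}) fstarstar) :
    fstarstar = fstar
      + (A₂.mulVec (H⁻¹.mulVec h +
            ((H⁻¹ * Sig * Hᵀ⁻¹) * A₁ᵀ * (A₁ * (H⁻¹ * Sig * Hᵀ⁻¹) * A₁ᵀ)⁻¹).mulVec
              (b₁ - A₁.mulVec (H⁻¹.mulVec h))) - b₂) ⬝ᵥ
          ((A₂ * ((H⁻¹ * Sig * Hᵀ⁻¹) -
              (H⁻¹ * Sig * Hᵀ⁻¹) * A₁ᵀ * (A₁ * (H⁻¹ * Sig * Hᵀ⁻¹) * A₁ᵀ)⁻¹ *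
                A₁ * (H⁻¹ * Sig * Hᵀ⁻¹)) * A₂ᵀ)⁻¹).mulVec
            (A₂.mulVec (H⁻¹.mulVec h +
              ((H⁻¹ * Sig * Hᵀ⁻¹) * A₁ᵀ * (A₁ * (H⁻¹ * Sig * Hᵀ⁻¹) * A₁ᵀ)⁻¹).mulVec
                (b₁ - A₁.mulVec (H⁻¹.mulVec h))) - b₂) := by
  have hHdet := (isUnit_iff_isUnit_det H).mp hH
  have hHtdet : IsUnit Hᵀ.det := by rwa [det_transpose]
  have hSdet := (isUnit_iff_isUnit_det Sig).mp hSig.isUnit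
  have hP : (Hᵀ * Sig⁻¹ * H).PosSemidef := by
    simpa using hSig.inv.posSemidef.conjTranspose_mul_mul_same H
  have hPQ : (Hᵀ * Sig⁻¹ * H) * (H⁻¹ * Sig * Hᵀ⁻¹) = 1 := by
    simp only [Matrix.mul_assoc, mul_nonsing_inv_cancel_left _ _ hHdet,
      nonsing_inv_mul_cancel_left _ _ hSdet, mul_nonsing_inv _ hHtdet]
  have hobj : (fun x => (H.mulVec x - h) ⬝ᵥ Sig⁻¹.mulVec (H.mulVec x - h)) =
      fun x => (x - H⁻¹ *ᵥ h) ⬝ᵥ (Hᵀ * Sig⁻¹ * H) *ᵥ (x - H⁻¹ *ᵥ h) := by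
    funext x
    have hres : H *ᵥ x - h = H *ᵥ (x - H⁻¹ *ᵥ h) := by
      rw [mulVec_sub, mulVec_mulVec, mul_nonsing_inv _ hHdet, one_mulVec]
    rw [hres, Matrix.mul_assoc, ← mulVec_mulVec, ← mulVec_mulVec, dotProduct_mulVec _ Hᵀ,
      vecMul_transpose]
  rw [hobj] at hf₁ hf₂
  exact quadratic_change_of_optimal_values hP hPQ _ h₁ hA hf₁ hf₂ rfl
end

section
/- (Weighted projector properties.) Let Q be a positive definite n×n real matrix and A₁ an m₁×n real matrix with A₁ Q A₁ᵀ invertible, and set C := Q − Q A₁ᵀ (A₁ Q A₁ᵀ)⁻¹ A₁ Q. Then C is symmetric and positive semidefinite, and A₁ C = 0. Moreover, if A₂ is an m₂×n real matrix such that the stacked matrix A (A₁ on top of A₂) satisfies that A Q Aᵀ is invertible, then A₂ C A₂ᵀ is positive definite. -/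
open Matrix

/-- The Schur-type complement `Q - Q Aᵀ (A Q Aᵀ)⁻¹ A Q` is the congruence of `Q` by the oblique
projector `1 - Q Aᵀ (A Q Aᵀ)⁻¹ A`. -/
lemma Matrix.weighted_projector_eq_congr {m n K : Type*} [Fintype m] [Fintype n] [DecidableEq m]
    [DecidableEq n] [Field K] {Q : Matrix n n K} (hQ : Qᵀ = Q) {A : Matrix m n K}
    (h : IsUnit (A * Q * Aᵀ)) :
    Q - Q * Aᵀ * (A * Q * Aᵀ)⁻¹ * A * Q =
      (1 - Q * Aᵀ * (A * Q * Aᵀ)⁻¹ * A) * Q * (1 - Q * Aᵀ * (A * Q * Aᵀ)⁻¹ * A)ᵀ := by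
  have hM : (A * Q * Aᵀ)ᵀ = A * Q * Aᵀ := by simp [transpose_mul, hQ, Matrix.mul_assoc]
  have hinv : (A * Q * Aᵀ)⁻¹ * (A * Q * Aᵀ) = 1 :=
    nonsing_inv_mul _ ((isUnit_iff_isUnit_det _).1 h)
  have ht : (1 - Q * Aᵀ * (A * Q * Aᵀ)⁻¹ * A)ᵀ = 1 - Aᵀ * ((A * Q * Aᵀ)⁻¹ * (A * Q)) := by
    rw [transpose_sub, transpose_one, transpose_mul, transpose_mul, transpose_nonsing_inv, hM,
      transpose_mul, transpose_transpose, hQ]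
  have hz : (1 - Q * Aᵀ * (A * Q * Aᵀ)⁻¹ * A) * Q * Aᵀ = 0 := by
    calc _ = Q * Aᵀ - Q * Aᵀ * ((A * Q * Aᵀ)⁻¹ * (A * Q * Aᵀ)) := by
          simp only [Matrix.sub_mul, Matrix.one_mul, Matrix.mul_assoc]
      _ = 0 := by rw [hinv, Matrix.mul_one, sub_self]
  rw [ht, Matrix.mul_sub, ← Matrix.mul_assoc _ Aᵀ, hz, Matrix.zero_mul, sub_zero, Matrix.mul_one,
    Matrix.sub_mul, Matrix.one_mul]

/-- If `A * B` is invertible then `A` has linearly independent rows. -/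
lemma Matrix.vecMul_injective_of_isUnit_mul {m n K : Type*} [Fintype m] [Fintype n]
    [DecidableEq m] [Field K] {A : Matrix m n K} {B : Matrix n m K} (h : IsUnit (A * B)) :
    Function.Injective A.vecMul := by
  intro x y hxy
  apply vecMul_injective_of_isUnit h
  change x ᵥ* A = y ᵥ* A at hxy
  change x ᵥ* (A * B) = y ᵥ* (A * B)
  rw [← vecMul_vecMul, hxy, vecMul_vecMul]


/-- Weighted projector properties: `C := Q - Q A₁ᵀ (A₁ Q A₁ᵀ)⁻¹ A₁ Q` is
symmetric and positive semidefinite with `A₁ C = 0`; and if the stacked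
matrix `A` makes `A Q Aᵀ` invertible, then `A₂ C A₂ᵀ` is positive definite. -/
theorem weighted_projector_properties {m₁ m₂ n : ℕ}
    (Q : Matrix (Fin n) (Fin n) ℝ) (hQ : Q.PosDef)
    (A₁ : Matrix (Fin m₁) (Fin n) ℝ)
    (h₁ : IsUnit (A₁ * Q * A₁ᵀ)) :
    (Q - Q * A₁ᵀ * (A₁ * Q * A₁ᵀ)⁻¹ * A₁ * Q)ᵀ
        = Q - Q * A₁ᵀ * (A₁ * Q * A₁ᵀ)⁻¹ * A₁ * Q ∧
    (Q - Q * A₁ᵀ * (A₁ * Q * A₁ᵀ)⁻¹ * A₁ * Q).PosSemidef ∧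
    A₁ * (Q - Q * A₁ᵀ * (A₁ * Q * A₁ᵀ)⁻¹ * A₁ * Q) = 0 ∧
    ∀ A₂ : Matrix (Fin m₂) (Fin n) ℝ,
      IsUnit (Matrix.fromRows A₁ A₂ * Q * (Matrix.fromRows A₁ A₂)ᵀ) →
      (A₂ * (Q - Q * A₁ᵀ * (A₁ * Q * A₁ᵀ)⁻¹ * A₁ * Q) * A₂ᵀ).PosDef := by
  have hQt : Qᵀ = Q := (conjTranspose_eq_transpose_of_trivial Q).symm.trans hQ.isHermitian
  have hC := weighted_projector_eq_congr hQt h₁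
  have hpsd : (Q - Q * A₁ᵀ * (A₁ * Q * A₁ᵀ)⁻¹ * A₁ * Q).PosSemidef := by
    rw [hC, ← conjTranspose_eq_transpose_of_trivial (1 - _)]
    exact hQ.posSemidef.mul_mul_conjTranspose_same _
  refine ⟨(conjTranspose_eq_transpose_of_trivial _).symm.trans hpsd.isHermitian, hpsd, ?_, fun A₂ h => ?_⟩
  · calc _ = A₁ * Q - (A₁ * Q * A₁ᵀ) * (A₁ * Q * A₁ᵀ)⁻¹ * (A₁ * Q) := by
          simp only [Matrix.mul_sub, Matrix.mul_assoc]
      _ = 0 := by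
          rw [mul_nonsing_inv _ ((isUnit_iff_isUnit_det _).1 h₁), Matrix.one_mul, sub_self]
  · set P := 1 - Q * A₁ᵀ * (A₁ * Q * A₁ᵀ)⁻¹ * A₁ with hP
    have hA₂P : A₂ * P =
        fromCols (-(A₂ * Q * A₁ᵀ * (A₁ * Q * A₁ᵀ)⁻¹))
          (1 : Matrix (Fin m₂) (Fin m₂) ℝ) * fromRows A₁ A₂ := by
      rw [fromCols_mul_fromRows, hP, Matrix.mul_sub, Matrix.mul_one, Matrix.one_mul,
        Matrix.neg_mul, neg_add_eq_sub]
      simp only [Matrix.mul_assoc]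
    have hinj : Function.Injective (A₂ * P).vecMul := by
      intro x y hxy
      change x ᵥ* (A₂ * P) = y ᵥ* (A₂ * P) at hxy
      rw [hA₂P, ← vecMul_vecMul, ← vecMul_vecMul] at hxy
      rw [Matrix.mul_assoc] at h
      have := vecMul_injective_of_isUnit_mul h hxy
      rw [vecMul_fromCols, vecMul_fromCols, vecMul_one, vecMul_one] at this
      exact (Sum.elim_eq_iff.1 this).2
    have hpos := hQ.mul_mul_conjTranspose_same hinj
    rw [conjTranspose_eq_transpose_of_trivial, transpose_mul] at hpos
    rw [hC]
    simpa only [Matrix.mul_assoc] using hpos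
end

section
/- (Monotonicity and exactness in least distance optimization.) Under the hypotheses of the least distance change-of-optimal-values result — H invertible, Σ positive definite, Q := H⁻¹ Σ H⁻ᵀ, A₁ Q A₁ᵀ and A Q Aᵀ invertible where A stacks A₁ on top of A₂, x₁⋆ := H⁻¹h + Q A₁ᵀ (A₁ Q A₁ᵀ)⁻¹ (b₁ − A₁ H⁻¹ h), f⋆ the least value of (H x − h)ᵀ Σ⁻¹ (H x − h) over {x : A₁ x = b₁}, f⋆⋆ the least value over {x : A₁ x = b₁ and A₂ x = b₂} — one has f⋆⋆ ≥ f⋆, with f⋆⋆ = f⋆ if and only if A₂ x₁⋆ = b₂. -/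
open Matrix

/-- Pythagorean identity for the quadratic form of a symmetric matrix. -/
theorem dotProduct_mulVec_add_of_orthogonal {ι : Type*} [Fintype ι] {M : Matrix ι ι ℝ}
    (hM : Mᵀ = M) {r e : ι → ℝ} (he : e ⬝ᵥ M *ᵥ r = 0) :
    (r + e) ⬝ᵥ M *ᵥ (r + e) = r ⬝ᵥ M *ᵥ r + e ⬝ᵥ M *ᵥ e := by
  have he' : r ⬝ᵥ M *ᵥ e = 0 := by
    rw [dotProduct_mulVec, ← mulVec_transpose, hM, dotProduct_comm, he]
  simp [mulVec_add, he, he']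

/-- The weighted residual at the closed-form minimizer lies in the range of `H⁻ᵀ A₁ᵀ`. -/
theorem inv_mulVec_residual {ι κ : Type*} [Fintype ι] [DecidableEq ι] [Fintype κ]
    {H S : Matrix ι ι ℝ} (hH : IsUnit H.det) (hS : IsUnit S.det) (h : ι → ℝ)
    (A : Matrix κ ι ℝ) (w : κ → ℝ) :
    S⁻¹ *ᵥ (H *ᵥ (H⁻¹ *ᵥ h + (H⁻¹ * S * Hᵀ⁻¹ * Aᵀ) *ᵥ w) - h) = (Hᵀ⁻¹ * Aᵀ) *ᵥ w := by
  simp only [mulVec_add, mulVec_mulVec, Matrix.mul_assoc, mul_nonsing_inv_cancel_left H _ hH,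
    mul_nonsing_inv H hH, one_mulVec, add_sub_cancel_left,
    nonsing_inv_mul_cancel_left S _ hS]

/-- Monotonicity and exactness in incremental least distance optimization:
`f⋆⋆ ≥ f⋆`, with equality iff the new constraint `A₂ x = b₂` is already
satisfied by the first-phase minimizer `x₁⋆`. -/
theorem leastDistance_increment_nonneg_and_exact {m₁ m₂ n : ℕ}
    (H Sig : Matrix (Fin n) (Fin n) ℝ)
    (hH : IsUnit H) (hSig : Sig.PosDef)
    (h : Fin n → ℝ)
    (A₁ : Matrix (Fin m₁) (Fin n) ℝ) (A₂ : Matrix (Fin m₂) (Fin n) ℝ)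
    (b₁ : Fin m₁ → ℝ) (b₂ : Fin m₂ → ℝ)
    (h₁ : IsUnit (A₁ * (H⁻¹ * Sig * Hᵀ⁻¹) * A₁ᵀ))
    (hA : IsUnit (Matrix.fromRows A₁ A₂ * (H⁻¹ * Sig * Hᵀ⁻¹) *
      (Matrix.fromRows A₁ A₂)ᵀ))
    (fstar fstarstar : ℝ)
    (hf₁ : IsLeast
      ((fun x => (H.mulVec x - h) ⬝ᵥ Sig⁻¹.mulVec (H.mulVec x - h)) ''
        {x | A₁.mulVec x = b₁}) fstar)
    (hf₂ : IsLeast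
      ((fun x => (H.mulVec x - h) ⬝ᵥ Sig⁻¹.mulVec (H.mulVec x - h)) ''
        {x | A₁.mulVec x = b₁ ∧ A₂.mulVec x = b₂}) fstarstar) :
    fstarstar ≥ fstar ∧
    (fstarstar = fstar ↔
      A₂.mulVec (H⁻¹.mulVec h +
        ((H⁻¹ * Sig * Hᵀ⁻¹) * A₁ᵀ * (A₁ * (H⁻¹ * Sig * Hᵀ⁻¹) * A₁ᵀ)⁻¹).mulVec
          (b₁ - A₁.mulVec (H⁻¹.mulVec h))) = b₂) := by
  have hHd : IsUnit H.det := (isUnit_iff_isUnit_det H).mp hH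
  have hSd : IsUnit Sig.det := (isUnit_iff_isUnit_det Sig).mp hSig.isUnit
  have hGd := (isUnit_iff_isUnit_det _).mp h₁
  rw [← mulVec_mulVec]
  set w := (A₁ * (H⁻¹ * Sig * Hᵀ⁻¹) * A₁ᵀ)⁻¹ *ᵥ (b₁ - A₁ *ᵥ (H⁻¹ *ᵥ h)) with hw
  set x₁ := H⁻¹ *ᵥ h + (H⁻¹ * Sig * Hᵀ⁻¹ * A₁ᵀ) *ᵥ w with hx₁
  have hfeas : A₁ *ᵥ x₁ = b₁ := by
    rw [hx₁, mulVec_add, mulVec_mulVec w, ← Matrix.mul_assoc, hw, mulVec_mulVec (b₁ - _),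
      mul_nonsing_inv _ hGd, one_mulVec, add_sub_cancel]
  have hres : Sig⁻¹ *ᵥ (H *ᵥ x₁ - h) = (Hᵀ⁻¹ * A₁ᵀ) *ᵥ w :=
    inv_mulVec_residual hHd hSd h A₁ w
  have hSinv : Sig⁻¹.PosDef := hSig.inv
  have hsymm : Sig⁻¹ᵀ = Sig⁻¹ := by
    simpa [conjTranspose_eq_transpose_of_trivial] using hSinv.isHermitian.eq
  have key : ∀ x, A₁ *ᵥ x = b₁ →
      (H *ᵥ x - h) ⬝ᵥ Sig⁻¹ *ᵥ (H *ᵥ x - h) =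
        (H *ᵥ x₁ - h) ⬝ᵥ Sig⁻¹ *ᵥ (H *ᵥ x₁ - h) +
          (H *ᵥ (x - x₁)) ⬝ᵥ Sig⁻¹ *ᵥ (H *ᵥ (x - x₁)) := by
    intro x hx
    have horth : (H *ᵥ (x - x₁)) ⬝ᵥ Sig⁻¹ *ᵥ (H *ᵥ x₁ - h) = 0 := by
      rw [hres, dotProduct_mulVec, ← mulVec_transpose, transpose_mul, transpose_transpose,
        transpose_nonsing_inv, transpose_transpose, mulVec_mulVec,
        nonsing_inv_mul_cancel_right _ _ hHd, mulVec_sub, hx, hfeas, sub_self, zero_dotProduct]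
    have hsplit : H *ᵥ x - h = (H *ᵥ x₁ - h) + H *ᵥ (x - x₁) := by
      rw [mulVec_sub]
      abel
    rw [hsplit, dotProduct_mulVec_add_of_orthogonal hsymm horth]
  have hnonneg : ∀ e, 0 ≤ e ⬝ᵥ Sig⁻¹ *ᵥ e := fun e => by
    simpa using hSinv.posSemidef.dotProduct_mulVec_nonneg e
  have hval : fstar = (H *ᵥ x₁ - h) ⬝ᵥ Sig⁻¹ *ᵥ (H *ᵥ x₁ - h) := by
    apply le_antisymm (hf₁.2 ⟨x₁, hfeas, rfl⟩)
    obtain ⟨x, hx, rfl⟩ := hf₁.1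
    exact (le_add_of_nonneg_right (hnonneg _)).trans_eq (key x hx).symm
  have hle : fstar ≤ fstarstar :=
    hf₁.2 (Set.image_mono (fun _ hx => hx.1) hf₂.1)
  refine ⟨hle, fun heq => ?_, fun hx => le_antisymm ?_ hle⟩
  · obtain ⟨x, ⟨hx1, hx2⟩, hx⟩ := hf₂.1
    have hzero : (H *ᵥ (x - x₁)) ⬝ᵥ Sig⁻¹ *ᵥ (H *ᵥ (x - x₁)) = 0 := by
      have := key x hx1
      dsimp only at hx
      linarith
    have hHx : H *ᵥ (x - x₁) = 0 := by
      by_contra hne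
      have := hSinv.dotProduct_mulVec_pos hne
      simp only [star_trivial] at this
      exact this.ne' hzero
    have hxx : x - x₁ = 0 := mulVec_injective_of_isUnit hH (by rw [hHx, mulVec_zero])
    rw [← sub_eq_zero.mp hxx, hx2]
  · rw [hval]
    exact hf₂.2 ⟨x₁, ⟨hfeas, hx⟩, rfl⟩
end
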